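/- arXiv:0803.3419 — 3 statements merged into one kernel-verified Lean document; each statement's English description precedes it below -/
import Mathlib

section
/- In ℚ(t), the rational function f = t³(t³ + 6³)³/(t³ − 3³)³ satisfies the composition identity f = (t³(t + 24)/(t − 3)) ∘ (t(t² − 6t + 36)/(t² + 3t + 9)). -/
open Polynomial

/-- Composition of rational functions: `rcomp g h = g ∘ h = g(h)`, the image of `g`
under the ℚ-algebra map ℚ(t) → ℚ(t) sending `t` to `h`. -/
noncomputable def rcomp (g h : RatFunc ℚ) : RatFunc ℚ :=
  Polynomial.aeval h g.num / Polynomial.aeval h g.denom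

/-- The degree of a rational function: the maximum of the degrees of its
coprime numerator and denominator. -/
noncomputable def rdeg (f : RatFunc ℚ) : ℕ :=
  max f.num.natDegree f.denom.natDegree

/-- A rational function is nonconstant if it is not in ℚ. -/
def Nonconst (f : RatFunc ℚ) : Prop := ∀ c : ℚ, f ≠ RatFunc.C c

/-- `f = f_N / f_D` (coprime) is in normal form if `deg f_N > deg f_D` and `f_N(0) = 0`. -/
def NormalForm (f : RatFunc ℚ) : Prop :=
  f.denom.natDegree < f.num.natDegree ∧ f.num.eval 0 = 0

/-- A unit with respect to composition: a rational function of degree 1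
(a linear fractional transformation). -/
noncomputable def IsCompUnit (u : RatFunc ℚ) : Prop := rdeg u = 1

/-- Composition may be computed from any fraction representing `g`, reduced or not,
as long as its denominator does not vanish at `h`. -/
lemma rcomp_div (p q : ℚ[X]) (h : RatFunc ℚ) (hq : aeval h q ≠ 0) :
    rcomp (algebraMap ℚ[X] (RatFunc ℚ) p / algebraMap ℚ[X] (RatFunc ℚ) q) h =
      aeval h p / aeval h q := by
  have hq0 : q ≠ 0 := by
    rintro rfl
    simp at hq
  obtain ⟨c, hc⟩ := RatFunc.denom_div_dvd p q
  have hd : aeval h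
      (algebraMap ℚ[X] (RatFunc ℚ) p / algebraMap ℚ[X] (RatFunc ℚ) q).denom ≠ 0 := by
    intro h0
    apply hq
    rw [hc, map_mul, h0, zero_mul]
  rw [rcomp, div_eq_div_iff hd hq, ← map_mul, ← map_mul,
    (RatFunc.num_mul_eq_mul_denom_iff hq0).2 rfl]

lemma algebraMap_ne_zero_of_eval_ne_zero {p : ℚ[X]} {a : ℚ} (hp : p.eval a ≠ 0) :
    algebraMap ℚ[X] (RatFunc ℚ) p ≠ 0 := by
  refine RatFunc.algebraMap_ne_zero ?_
  rintro rfl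
  simp at hp

/-- The rational function `f = t³(t³ + 6³)³/(t³ − 3³)³` decomposes as
`f = (t³(t + 24)/(t − 3)) ∘ (t(t² − 6t + 36)/(t² + 3t + 9))`. -/
theorem decomposition_length_two :
    (RatFunc.X ^ 3 * (RatFunc.X ^ 3 + RatFunc.C (6 ^ 3 : ℚ)) ^ 3) /
        (RatFunc.X ^ 3 - RatFunc.C (3 ^ 3 : ℚ)) ^ 3 =
      rcomp
        (RatFunc.X ^ 3 * (RatFunc.X + RatFunc.C (24 : ℚ)) / (RatFunc.X - RatFunc.C (3 : ℚ)))
        (RatFunc.X * (RatFunc.X ^ 2 - RatFunc.C (6 : ℚ) * RatFunc.X + RatFunc.C (36 : ℚ)) /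
          (RatFunc.X ^ 2 + RatFunc.C (3 : ℚ) * RatFunc.X + RatFunc.C (9 : ℚ))) := by
  have hX : (RatFunc.X - 3 : RatFunc ℚ) ≠ 0 := by
    have h := algebraMap_ne_zero_of_eval_ne_zero (p := X - C 3) (a := 0) (by simp)
    rwa [map_sub, RatFunc.algebraMap_X, RatFunc.algebraMap_C, map_ofNat] at h
  have hQ : (RatFunc.X ^ 2 + 3 * RatFunc.X + 9 : RatFunc ℚ) ≠ 0 := by
    have h := algebraMap_ne_zero_of_eval_ne_zero (p := X ^ 2 + C 3 * X + C 9) (a := 0) (by simp)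
    rwa [map_add, map_add, map_mul, map_pow, RatFunc.algebraMap_X, RatFunc.algebraMap_C,
      RatFunc.algebraMap_C, map_ofNat, map_ofNat] at h
  have hg : (RatFunc.X ^ 3 * (RatFunc.X + RatFunc.C (24 : ℚ)) /
      (RatFunc.X - RatFunc.C (3 : ℚ)) : RatFunc ℚ) =
      algebraMap ℚ[X] (RatFunc ℚ) (X ^ 3 * (X + C 24)) /
        algebraMap ℚ[X] (RatFunc ℚ) (X - C 3) := by
    simp
  rw [hg]
  simp only [map_pow, map_ofNat]
  generalize (RatFunc.X : RatFunc ℚ) = t at hX hQ ⊢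
  have h3 : t * (t ^ 2 - 6 * t + 36) / (t ^ 2 + 3 * t + 9) - 3 =
      (t - 3) ^ 3 / (t ^ 2 + 3 * t + 9) := by
    rw [div_sub' hQ, div_left_inj' hQ]
    ring
  have h24 : t * (t ^ 2 - 6 * t + 36) / (t ^ 2 + 3 * t + 9) + 24 =
      (t + 6) ^ 3 / (t ^ 2 + 3 * t + 9) := by
    rw [div_add' _ _ _ hQ, div_left_inj' hQ]
    ring
  have hcube : t ^ 3 - 3 ^ 3 = (t - 3) * (t ^ 2 + 3 * t + 9) := by ring
  rw [← map_ofNat (C : ℚ →+* ℚ[X]) 24, ← map_ofNat (C : ℚ →+* ℚ[X]) 3, rcomp_div]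
  · simp only [map_mul, map_pow, map_add, map_sub, aeval_X, map_ofNat]
    rw [h3, h24, hcube]
    field_simp
    ring
  · simp only [map_sub, aeval_X, map_ofNat]
    rw [h3]
    exact div_ne_zero (pow_ne_zero 3 hX) hQ
end

section
/- There exists a rational function f ∈ ℚ(t) admitting refined decompositions of different lengths: namely, f = t³(t³ + 6³)³/(t³ − 3³)³ has a refined decomposition of length 3, f = t³ ∘ (t(t − 12)/(t − 3)) ∘ (t(t + 6)/(t − 3)), in which each component is indecomposable (of degrees 3, 2, 2), and a refined decomposition of length 2, f = (t³(t + 24)/(t − 3)) ∘ (t(t² − 6t + 36)/(t² + 3t + 9)), in which each component is indecomposable (of degrees 4, 3). -/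
open Polynomial

/-- A rational function is indecomposable if it is nonconstant, not a unit under
composition, and in every decomposition into two nonconstant rational functions one
of the components is a unit. -/
noncomputable def Indecomposable (f : RatFunc ℚ) : Prop :=
  Nonconst f ∧ ¬ IsCompUnit f ∧
  ∀ g h : RatFunc ℚ, Nonconst g → Nonconst h → f = rcomp g h →
    IsCompUnit g ∨ IsCompUnit h

section Composition

open IntermediateField

variable {K : Type*} [Field K]

/-- Substitution `g ↦ g(h)` of a nonconstant `h`, as an endomorphism of `K(t)`. -/
noncomputable def RatFunc.substHom (h : RatFunc K) (hh : ¬∃ c, h = RatFunc.C c) :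
    RatFunc K →ₐ[K] RatFunc K :=
  K⟮h⟯.val.comp (RatFunc.algEquivOfTranscendental h (h.transcendental_of_ne_C hh)).toAlgHom

theorem RatFunc.substHom_apply (h : RatFunc K) (hh : ¬∃ c, h = RatFunc.C c) (g : RatFunc K) :
    h.substHom hh g = aeval h g.num / aeval h g.denom := by
  simp [substHom, RatFunc.algEquivOfTranscendental_apply]

@[simp]
theorem RatFunc.substHom_X (h : RatFunc K) (hh : ¬∃ c, h = RatFunc.C c) :
    h.substHom hh RatFunc.X = h := by
  simp [substHom]

theorem RatFunc.finrank_adjoin_substHom (g h : RatFunc K) (hh : ¬∃ c, h = RatFunc.C c) :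
    Module.finrank K⟮h.substHom hh g⟯ (RatFunc K) =
      Module.finrank K⟮g⟯ (RatFunc K) * Module.finrank K⟮h⟯ (RatFunc K) := by
  have hmap (u : RatFunc K) : K⟮u⟯.map (h.substHom hh) = K⟮h.substHom hh u⟯ := by
    rw [adjoin_map, Set.image_singleton]
  have htop : (⊤ : IntermediateField K (RatFunc K)).map (h.substHom hh) = K⟮h⟯ := by
    rw [← RatFunc.adjoin_X, hmap, substHom_X]
  have hle : K⟮h.substHom hh g⟯ ≤ K⟮h⟯ := by
    rw [← hmap, ← htop]
    exact map_mono _ le_top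
  have hrel : relfinrank K⟮h.substHom hh g⟯ K⟮h⟯ = Module.finrank K⟮g⟯ (RatFunc K) := by
    rw [← hmap, ← htop, relfinrank_map_map, relfinrank_top_right]
  rw [← relfinrank_mul_finrank_top hle, hrel]

end Composition

theorem Nonconst.not_exists {h : RatFunc ℚ} (hh : Nonconst h) : ¬∃ c, h = RatFunc.C c :=
  fun ⟨c, hc⟩ => hh c hc

theorem aeval_ratAlgebra (h : RatFunc ℚ) (P : ℚ[X]) :
    aeval h P = @aeval ℚ (RatFunc ℚ) _ _ (RatFunc.instAlgebraOfPolynomial ℚ ℚ) h P :=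
  congrArg (fun i : Algebra ℚ (RatFunc ℚ) => @aeval ℚ (RatFunc ℚ) _ _ i h P)
    (Subsingleton.elim _ _)

theorem substHom_eq_rcomp {h : RatFunc ℚ} (hh : Nonconst h) (g : RatFunc ℚ) :
    h.substHom hh.not_exists g = rcomp g h := by
  rw [RatFunc.substHom_apply, rcomp, aeval_ratAlgebra, aeval_ratAlgebra]

theorem rdeg_rcomp (g h : RatFunc ℚ) (hh : Nonconst h) :
    rdeg (rcomp g h) = rdeg g * rdeg h := by
  have hmul := RatFunc.finrank_adjoin_substHom g h hh.not_exists
  rwa [RatFunc.finrank_eq_max_natDegree, RatFunc.finrank_eq_max_natDegree,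
    RatFunc.finrank_eq_max_natDegree, substHom_eq_rcomp hh] at hmul

theorem rdeg_div {A B : ℚ[X]} (hAB : IsCoprime A B) (hB : B ≠ 0) :
    rdeg (algebraMap ℚ[X] (RatFunc ℚ) A / algebraMap ℚ[X] (RatFunc ℚ) B) =
      max A.natDegree B.natDegree := by
  set f := algebraMap ℚ[X] (RatFunc ℚ) A / algebraMap ℚ[X] (RatFunc ℚ) B with hf
  have key : f.num * B = A * f.denom := (RatFunc.num_mul_eq_mul_denom_iff hB).2 hf
  have hc := f.isCoprime_num_denom
  have hA : Associated f.num A := associated_of_dvd_dvd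
    (hc.dvd_of_dvd_mul_right (Dvd.intro _ key)) (hAB.dvd_of_dvd_mul_right (Dvd.intro _ key.symm))
  have hD : Associated f.denom B := associated_of_dvd_dvd
    (hc.symm.dvd_of_dvd_mul_left (Dvd.intro_left _ key.symm))
    (hAB.symm.dvd_of_dvd_mul_left (Dvd.intro_left _ key))
  rw [rdeg, natDegree_eq_of_degree_eq (degree_eq_degree_of_associated hA),
    natDegree_eq_of_degree_eq (degree_eq_degree_of_associated hD)]

theorem nonconst_of_rdeg_ne_zero {f : RatFunc ℚ} (hf : rdeg f ≠ 0) : Nonconst f := by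
  rintro c rfl
  exact hf (by rw [rdeg, RatFunc.num_C, RatFunc.denom_C]; simp)

theorem indecomposable_of_rdeg_prime {f : RatFunc ℚ} (hf : (rdeg f).Prime) :
    Indecomposable f := by
  refine ⟨nonconst_of_rdeg_ne_zero hf.ne_zero, hf.ne_one, ?_⟩
  rintro g h - hh rfl
  rw [rdeg_rcomp g h hh, Nat.prime_mul_iff] at hf
  exact hf.symm.imp And.right And.right

theorem isCoprime_of_eq_C {A B u v : ℚ[X]} {k : ℚ} (hk : k ≠ 0) (h : u * A + v * B = C k) :
    IsCoprime A B :=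
  ⟨C k⁻¹ * u, C k⁻¹ * v, by
    rw [mul_assoc, mul_assoc, ← mul_add, h, ← C_mul, inv_mul_cancel₀ hk, C_1]⟩

/-- The fibre of type (3, 1) of `t³(t + 24)` over `0` rules out a quadratic form in two
polynomials of degree at most two. -/
theorem quadratic_form_ne_of_eval_ne_zero {A B : ℚ[X]} (hA : A.natDegree ≤ 2)
    (hB : B.natDegree ≤ 2) (hB0 : B.eval 0 ≠ 0) (n₀ n₁ n₂ : ℚ) {c : ℚ} (hc : c ≠ 0) :
    C n₀ * B ^ 2 + C n₁ * A * B + C n₂ * A ^ 2 ≠ C c * (X ^ 3 * (X + 24)) := by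
  intro h
  set a := A.eval 0 with ha
  set b := B.eval 0 with hb
  have h0 : n₀ * b ^ 2 + n₁ * a * b + n₂ * a ^ 2 = 0 := by
    simpa [← ha, ← hb] using congrArg (eval 0) h
  set L := C b * A - C a * B with hL
  set M := C (n₂ * b) * A + C (n₁ * b + n₂ * a) * B with hM
  have hLM : L * M = C (b ^ 2 * c) * (X ^ 3 * (X + 24)) := by
    have h0' := congrArg (C : ℚ → ℚ[X]) h0
    simp only [map_add, map_mul, map_pow, map_zero] at h0'
    simp only [hL, hM, map_add, map_mul, map_pow]
    linear_combination C b ^ 2 * h - B ^ 2 * h0'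
  have hk : b ^ 2 * c ≠ 0 := by positivity
  have hP : (X ^ 3 * (X + 24) : ℚ[X]) ≠ 0 :=
    mul_ne_zero (pow_ne_zero _ X_ne_zero) (X_add_C_ne_zero 24)
  have hLM0 : L * M ≠ 0 := by
    rw [hLM]
    exact mul_ne_zero (C_ne_zero.2 hk) hP
  have hLdeg : L.natDegree ≤ 2 :=
    (natDegree_sub_le _ _).trans
      (max_le ((natDegree_C_mul_le _ _).trans hA) ((natDegree_C_mul_le _ _).trans hB))
  have hXM : X ∣ M := by
    by_contra hXM
    have h3 : X ^ 3 ∣ L := prime_X.pow_dvd_of_dvd_mul_right 3 hXM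
      (hLM ▸ Dvd.intro_left (C (b ^ 2 * c) * (X + 24)) (by ring))
    have := natDegree_le_of_dvd h3 (left_ne_zero_of_mul hLM0)
    rw [natDegree_X_pow] at this
    omega
  have hM0 : n₂ * b * a + (n₁ * b + n₂ * a) * b = 0 := by
    have := eval_eq_zero_of_dvd_of_eval_eq_zero hXM (x := 0) (by simp)
    simpa [hM, ← ha, ← hb] using this
  have hn : n₁ * b + n₂ * a = -(n₂ * a) := by
    apply mul_right_cancel₀ hB0
    linear_combination hM0
  have hML : M = C n₂ * L := by
    rw [hM, hn, hL]
    simp only [map_mul, map_neg]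
    ring
  have hroot : L.eval (-24) = 0 := by
    have h1 := congrArg (eval (-24)) hLM
    have h2 : n₂ ≠ 0 := by
      rintro rfl
      simp [hML] at hLM0
    rw [hML] at h1
    simpa [h2] using h1
  obtain ⟨V, hV⟩ := dvd_iff_isRoot.2 hroot
  have h4 : (X + 24) * (C n₂ * ((X + 24) * V ^ 2)) = (X + 24) * (C (b ^ 2 * c) * X ^ 3) := by
    rw [hML, hV] at hLM
    simp only [map_neg, map_ofNat, sub_neg_eq_add] at hLM
    linear_combination hLM
  have h5 := congrArg (eval (-24)) (mul_left_cancel₀ (X_add_C_ne_zero (24 : ℚ)) h4)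
  simp at h5
  tauto

theorem quadratic_form_ne {A B : ℚ[X]} (hA : A.natDegree ≤ 2) (hB : B.natDegree ≤ 2)
    (hAB : IsCoprime A B) (n₀ n₁ n₂ : ℚ) {c : ℚ} (hc : c ≠ 0) :
    C n₀ * B ^ 2 + C n₁ * A * B + C n₂ * A ^ 2 ≠ C c * (X ^ 3 * (X + 24)) := by
  by_cases hB0 : B.eval 0 = 0
  · have hA0 : A.eval 0 ≠ 0 := by
      intro hA0
      obtain ⟨u, v, h⟩ := hAB
      simpa [hA0, hB0] using congrArg (eval 0) h
    intro h
    refine quadratic_form_ne_of_eval_ne_zero hB hA hA0 n₂ n₁ n₀ hc ?_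
    linear_combination h
  · exact quadratic_form_ne_of_eval_ne_zero hA hB hB0 n₀ n₁ n₂ hc

theorem aeval_mul_sq {K : Type*} [Field K] {P A B : K[X]} (hP : P.natDegree ≤ 2) (hB : B ≠ 0) :
    aeval (algebraMap K[X] (RatFunc K) A / algebraMap K[X] (RatFunc K) B) P *
        algebraMap K[X] (RatFunc K) B ^ 2 =
      algebraMap K[X] (RatFunc K)
        (C (P.coeff 0) * B ^ 2 + C (P.coeff 1) * A * B + C (P.coeff 2) * A ^ 2) := by
  have hB' := RatFunc.algebraMap_ne_zero hB
  rw [aeval_eq_sum_range' (Nat.lt_succ_of_le hP)]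
  simp only [Finset.sum_range_succ, Finset.sum_range_zero, RatFunc.smul_eq_C_mul, map_add,
    map_mul, map_pow, RatFunc.algebraMap_C]
  field_simp
  ring

theorem natDegree_quadratic_form_le {A B : ℚ[X]} (hA : A.natDegree ≤ 2) (hB : B.natDegree ≤ 2)
    (n₀ n₁ n₂ : ℚ) :
    (C n₀ * B ^ 2 + C n₁ * A * B + C n₂ * A ^ 2).natDegree ≤ 4 := by
  compute_degree
  omega

theorem rcomp_ne_of_rdeg_eq_two {g h : RatFunc ℚ} (hg : rdeg g = 2) (hh : rdeg h = 2) :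
    rcomp g h ≠ algebraMap ℚ[X] (RatFunc ℚ) (X ^ 3 * (X + 24)) /
      algebraMap ℚ[X] (RatFunc ℚ) (X - 3) := by
  intro heq
  have hhc : Nonconst h := nonconst_of_rdeg_ne_zero (by omega)
  have hA : h.num.natDegree ≤ 2 := hh ▸ le_max_left _ _
  have hB : h.denom.natDegree ≤ 2 := hh ▸ le_max_right _ _
  have hN := aeval_mul_sq (A := h.num) (hg ▸ le_max_left _ _ : g.num.natDegree ≤ 2) h.denom_ne_zero
  have hD := aeval_mul_sq (A := h.num) (hg ▸ le_max_right _ _ : g.denom.natDegree ≤ 2)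
    h.denom_ne_zero
  rw [RatFunc.num_div_denom, ← aeval_ratAlgebra] at hN hD
  have hX3 : (X - 3 : ℚ[X]) ≠ 0 := X_sub_C_ne_zero 3
  have hX3' := RatFunc.algebraMap_ne_zero hX3
  have hB' := RatFunc.algebraMap_ne_zero h.denom_ne_zero
  have hD0 : aeval h g.denom ≠ 0 := by
    intro h0
    rw [aeval_ratAlgebra] at h0
    exact h.transcendental_of_ne_C hhc.not_exists ⟨_, g.denom_ne_zero, h0⟩
  have hP : (X ^ 3 * (X + 24) : ℚ[X]) ≠ 0 :=
    mul_ne_zero (pow_ne_zero _ X_ne_zero) (X_add_C_ne_zero 24)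
  set N := C (g.num.coeff 0) * h.denom ^ 2 + C (g.num.coeff 1) * h.num * h.denom +
    C (g.num.coeff 2) * h.num ^ 2 with hNdef
  set D := C (g.denom.coeff 0) * h.denom ^ 2 + C (g.denom.coeff 1) * h.num * h.denom +
    C (g.denom.coeff 2) * h.num ^ 2
  have hcross : N * (X - 3) = X ^ 3 * (X + 24) * D := by
    apply RatFunc.algebraMap_injective ℚ
    rw [rcomp, div_eq_div_iff hD0 hX3'] at heq
    rw [map_mul, map_mul _ _ D, ← hN, ← hD]
    linear_combination heq * algebraMap ℚ[X] (RatFunc ℚ) h.denom ^ 2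
  have hDne : D ≠ 0 := by
    intro h0
    rw [h0, map_zero] at hD
    exact mul_ne_zero hD0 (pow_ne_zero 2 hB') hD
  have hN0 : N ≠ 0 := by
    intro h0
    rw [h0, zero_mul] at hcross
    exact mul_ne_zero hP hDne hcross.symm
  have hcop : IsCoprime (X ^ 3 * (X + 24) : ℚ[X]) (X - 3) := by
    refine IsCoprime.mul_left (IsCoprime.pow_left ?_) ?_
    · exact isCoprime_of_eq_C (u := 1) (v := -1) (k := 3) (by norm_num)
        (by simp only [map_ofNat]; ring)
    · exact isCoprime_of_eq_C (u := 1) (v := -1) (k := 27) (by norm_num)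
        (by simp only [map_ofNat]; ring)
  obtain ⟨Q, hQ⟩ := hcop.dvd_of_dvd_mul_right (Dvd.intro _ hcross.symm)
  have hQ0 : Q ≠ 0 := by
    rintro rfl
    simp [hN0] at hQ
  have hPdeg : (X ^ 3 * (X + 24) : ℚ[X]).natDegree = 4 := by compute_degree!
  have hQdeg : Q.natDegree = 0 := by
    have h1 := natDegree_quadratic_form_le hA hB (g.num.coeff 0) (g.num.coeff 1) (g.num.coeff 2)
    rw [← hNdef, hQ, natDegree_mul hP hQ0, hPdeg] at h1
    omega
  rw [eq_C_of_natDegree_eq_zero hQdeg] at hQ hQ0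
  exact quadratic_form_ne hA hB h.isCoprime_num_denom _ _ _ (C_ne_zero.1 hQ0)
    (hNdef.symm.trans (hQ.trans (mul_comm _ _)))

theorem div_mul_div_div_eq {F : Type*} [Field F] (x y z : F) {e : F} (he : e ≠ 0) :
    x / e * (y / e) / (z / e) = x * y / (e * z) := by
  field_simp

theorem div_pow_mul_div_div_eq {F : Type*} [Field F] (x y z : F) {d : F} (hd : d ≠ 0) :
    (x / d) ^ 3 * (y ^ 3 / d) / (z ^ 3 / d) = (x * y) ^ 3 / (z * d) ^ 3 := by
  field_simp

/-- There is a rational function with refined decomposition chains of different lengths: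
`f = t³(t³ + 6³)³/(t³ − 3³)³` admits the refined decomposition of length 3
`f = t³ ∘ (t(t − 12)/(t − 3)) ∘ (t(t + 6)/(t − 3))` (indecomposable components of
degrees 3, 2, 2) and the refined decomposition of length 2
`f = (t³(t + 24)/(t − 3)) ∘ (t(t² − 6t + 36)/(t² + 3t + 9))` (indecomposable components
of degrees 4, 3). -/
theorem refined_decompositions_of_different_lengths :
    ∃ f a b c p q : RatFunc ℚ,
      f = (RatFunc.X ^ 3 * (RatFunc.X ^ 3 + RatFunc.C (6 ^ 3 : ℚ)) ^ 3) /
            (RatFunc.X ^ 3 - RatFunc.C (3 ^ 3 : ℚ)) ^ 3 ∧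
      a = RatFunc.X ^ 3 ∧
      b = RatFunc.X * (RatFunc.X - RatFunc.C (12 : ℚ)) / (RatFunc.X - RatFunc.C (3 : ℚ)) ∧
      c = RatFunc.X * (RatFunc.X + RatFunc.C (6 : ℚ)) / (RatFunc.X - RatFunc.C (3 : ℚ)) ∧
      p = RatFunc.X ^ 3 * (RatFunc.X + RatFunc.C (24 : ℚ)) /
            (RatFunc.X - RatFunc.C (3 : ℚ)) ∧
      q = RatFunc.X * (RatFunc.X ^ 2 - RatFunc.C (6 : ℚ) * RatFunc.X + RatFunc.C (36 : ℚ)) /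
            (RatFunc.X ^ 2 + RatFunc.C (3 : ℚ) * RatFunc.X + RatFunc.C (9 : ℚ)) ∧
      f = rcomp (rcomp a b) c ∧
      Indecomposable a ∧ Indecomposable b ∧ Indecomposable c ∧
      rdeg a = 3 ∧ rdeg b = 2 ∧ rdeg c = 2 ∧
      f = rcomp p q ∧
      Indecomposable p ∧ Indecomposable q ∧
      rdeg p = 4 ∧ rdeg q = 3 := by
  have hX3 : (X - 3 : ℚ[X]) ≠ 0 := X_sub_C_ne_zero 3
  have hqden : (X ^ 2 + 3 * X + 9 : ℚ[X]) ≠ 0 := by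
    refine Monic.ne_zero ?_
    monicity!
  have hx3 : (RatFunc.X - 3 : RatFunc ℚ) ≠ 0 := by
    simpa [map_ofNat] using RatFunc.algebraMap_ne_zero hX3
  have hxq : (RatFunc.X ^ 2 + 3 * RatFunc.X + 9 : RatFunc ℚ) ≠ 0 := by
    simpa [map_ofNat] using RatFunc.algebraMap_ne_zero hqden
  have hda : rdeg (RatFunc.X ^ 3 : RatFunc ℚ) = 3 := by
    have := rdeg_div (isCoprime_one_right (x := (X ^ 3 : ℚ[X]))) one_ne_zero
    simpa [map_ofNat] using this
  have hdb : rdeg (RatFunc.X * (RatFunc.X - 12) / (RatFunc.X - 3) : RatFunc ℚ) = 2 := by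
    have hcop : IsCoprime (X * (X - 12) : ℚ[X]) (X - 3) :=
      isCoprime_of_eq_C (u := 1) (v := 9 - X) (k := -27) (by norm_num)
        (by simp only [map_neg, map_ofNat]; ring)
    have h1 : (X * (X - 12) : ℚ[X]).natDegree = 2 := by compute_degree!
    have h2 : (X - 3 : ℚ[X]).natDegree = 1 := by compute_degree!
    have := rdeg_div hcop hX3
    rw [h1, h2] at this
    simpa [map_ofNat] using this
  have hdc : rdeg (RatFunc.X * (RatFunc.X + 6) / (RatFunc.X - 3) : RatFunc ℚ) = 2 := by
    have hcop : IsCoprime (X * (X + 6) : ℚ[X]) (X - 3) :=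
      isCoprime_of_eq_C (u := 1) (v := -(X + 9)) (k := 27) (by norm_num)
        (by simp only [map_ofNat]; ring)
    have h1 : (X * (X + 6) : ℚ[X]).natDegree = 2 := by compute_degree!
    have h2 : (X - 3 : ℚ[X]).natDegree = 1 := by compute_degree!
    have := rdeg_div hcop hX3
    rw [h1, h2] at this
    simpa [map_ofNat] using this
  have hdp : rdeg (RatFunc.X ^ 3 * (RatFunc.X + 24) / (RatFunc.X - 3) : RatFunc ℚ) = 4 := by
    have hcop : IsCoprime (X ^ 3 * (X + 24) : ℚ[X]) (X - 3) :=
      isCoprime_of_eq_C (u := 1) (v := -(X ^ 3 + 27 * X ^ 2 + 81 * X + 243)) (k := 729)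
        (by norm_num) (by simp only [map_ofNat]; ring)
    have h1 : (X ^ 3 * (X + 24) : ℚ[X]).natDegree = 4 := by compute_degree!
    have h2 : (X - 3 : ℚ[X]).natDegree = 1 := by compute_degree!
    have := rdeg_div hcop hX3
    rw [h1, h2] at this
    simpa [map_ofNat] using this
  have hdq : rdeg (RatFunc.X * (RatFunc.X ^ 2 - 6 * RatFunc.X + 36) /
      (RatFunc.X ^ 2 + 3 * RatFunc.X + 9) : RatFunc ℚ) = 3 := by
    have hcop : IsCoprime (X * (X ^ 2 - 6 * X + 36) : ℚ[X]) (X ^ 2 + 3 * X + 9) := by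
      refine IsCoprime.mul_left ?_ ?_
      · exact isCoprime_of_eq_C (u := -(X + 3)) (v := 1) (k := 9) (by norm_num)
          (by simp only [map_ofNat]; ring)
      · exact isCoprime_of_eq_C (u := X + 6) (v := 9 - (X + 6)) (k := 243) (by norm_num)
          (by simp only [map_ofNat]; ring)
    have h1 : (X * (X ^ 2 - 6 * X + 36) : ℚ[X]).natDegree = 3 := by compute_degree!
    have h2 : (X ^ 2 + 3 * X + 9 : ℚ[X]).natDegree = 2 := by compute_degree!
    have := rdeg_div hcop hqden
    rw [h1, h2] at this
    simpa [map_ofNat] using this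
  refine ⟨_, _, _, _, _, _, rfl, rfl, rfl, rfl, rfl, rfl, ?_⟩
  simp only [map_ofNat, map_pow]
  have hcb := nonconst_of_rdeg_ne_zero (hdb.trans_ne two_ne_zero)
  have hcc := nonconst_of_rdeg_ne_zero (hdc.trans_ne two_ne_zero)
  have hcq := nonconst_of_rdeg_ne_zero (hdq.trans_ne three_ne_zero)
  refine ⟨?_, indecomposable_of_rdeg_prime (by rw [hda]; exact Nat.prime_three),
    indecomposable_of_rdeg_prime (by rw [hdb]; exact Nat.prime_two),
    indecomposable_of_rdeg_prime (by rw [hdc]; exact Nat.prime_two), hda, hdb, hdc, ?_, ?_,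
    indecomposable_of_rdeg_prime (by rw [hdq]; exact Nat.prime_three), hdp, hdq⟩
  · rw [← substHom_eq_rcomp hcc, ← substHom_eq_rcomp hcb]
    simp only [map_pow, map_div₀, map_mul, map_sub, RatFunc.substHom_X, map_ofNat]
    have h12 : (RatFunc.X * (RatFunc.X + 6) / (RatFunc.X - 3) - 12 : RatFunc ℚ) =
        (RatFunc.X ^ 2 - 6 * RatFunc.X + 36) / (RatFunc.X - 3) := by
      field_simp
      ring
    have h3 : (RatFunc.X * (RatFunc.X + 6) / (RatFunc.X - 3) - 3 : RatFunc ℚ) =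
        (RatFunc.X ^ 2 + 3 * RatFunc.X + 9) / (RatFunc.X - 3) := by
      field_simp
      ring
    rw [h12, h3, div_mul_div_div_eq _ _ _ hx3, div_pow]
    ring
  · rw [← substHom_eq_rcomp hcq]
    simp only [map_pow, map_div₀, map_mul, map_sub, map_add, RatFunc.substHom_X, map_ofNat]
    have h24 : (RatFunc.X * (RatFunc.X ^ 2 - 6 * RatFunc.X + 36) /
        (RatFunc.X ^ 2 + 3 * RatFunc.X + 9) + 24 : RatFunc ℚ) =
        (RatFunc.X + 6) ^ 3 / (RatFunc.X ^ 2 + 3 * RatFunc.X + 9) := by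
      rw [div_add' _ _ _ hxq]
      ring
    have h3 : (RatFunc.X * (RatFunc.X ^ 2 - 6 * RatFunc.X + 36) /
        (RatFunc.X ^ 2 + 3 * RatFunc.X + 9) - 3 : RatFunc ℚ) =
        (RatFunc.X - 3) ^ 3 / (RatFunc.X ^ 2 + 3 * RatFunc.X + 9) := by
      rw [div_sub' hxq]
      ring
    rw [h24, h3, div_pow_mul_div_div_eq _ _ _ hxq]
    ring
  · refine ⟨nonconst_of_rdeg_ne_zero (hdp.trans_ne four_ne_zero), ?_, ?_⟩
    · rw [IsCompUnit, hdp]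
      norm_num
    · intro g h _ hh heq
      have hmul := rdeg_rcomp g h hh
      rw [← heq, hdp] at hmul
      have hne : ¬ (rdeg g = 2 ∧ rdeg h = 2) := fun ⟨h1, h2⟩ =>
        rcomp_ne_of_rdeg_eq_two h1 h2 (by simpa [map_ofNat] using heq.symm)
      have hg4 : rdeg g ≤ 4 := Nat.le_of_dvd (by norm_num) (Dvd.intro _ hmul.symm)
      unfold IsCompUnit
      interval_cases rdeg g <;> omega
end

section
/- Let f ∈ ℚ(t) be a nonconstant rational function in normal form with coprime numerator f_N and denominator f_D. Then every decomposition f = g ∘ h into nonconstant rational functions is equivalent to one in which the right component h = h_N/h_D is in normal form with h_N a monic divisor of f_N and h_D a monic divisor of f_D; consequently, every class of decompositions of f (up to unit equivalence) has a representative whose right component is A/B with A a monic divisor of f_N and B a monic divisor of f_D. -/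
open Polynomial

section HomogenizedEvaluation

variable {k : Type*} [Field k]

/-- The value at `(a, b)` of the binary form of degree `n` obtained by homogenizing `p`. -/
noncomputable def homEval {R : Type*} [CommRing R] [Algebra k R] (n : ℕ) (p : k[X]) (a b : R) : R :=
  ∑ i ∈ Finset.range (n + 1), algebraMap k R (p.coeff i) * a ^ i * b ^ (n - i)

theorem map_homEval {R S : Type*} [CommRing R] [Algebra k R] [CommRing S] [Algebra k S]
    (φ : R →ₐ[k] S) (n : ℕ) (p : k[X]) (a b : R) :
    φ (homEval n p a b) = homEval n p (φ a) (φ b) := by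
  simp [homEval]

theorem homEval_mul_mul {R : Type*} [CommRing R] [Algebra k R] (n : ℕ) (p : k[X]) (c a b : R) :
    homEval n p (c * a) (c * b) = c ^ n * homEval n p a b := by
  rw [homEval, homEval, Finset.mul_sum]
  refine Finset.sum_congr rfl fun i hi ↦ ?_
  have : c ^ n = c ^ i * c ^ (n - i) := by
    rw [← pow_add, Nat.add_sub_cancel' (by grind)]
  rw [this, mul_pow, mul_pow]
  ring

theorem homEval_one_right {R : Type*} [CommRing R] [Algebra k R] {n : ℕ} {p : k[X]}
    (hp : p.natDegree ≤ n) (a : R) : homEval n p a 1 = aeval a p := by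
  rw [aeval_eq_sum_range' (Nat.lt_succ_of_le hp)]
  simp [homEval, Algebra.smul_def]

theorem homEval_zero_right {R : Type*} [CommRing R] [Algebra k R] (n : ℕ) (p : k[X]) (a : R) :
    homEval n p a 0 = algebraMap k R (p.coeff n) * a ^ n := by
  rw [homEval, Finset.sum_eq_single n]
  · simp
  · intro i hi hin
    have : n - i ≠ 0 := by grind
    simp [this]
  · simp

theorem homEval_eq_pow_mul_aeval_div {K : Type*} [Field K] [Algebra k K] {n : ℕ} {p : k[X]}
    (hp : p.natDegree ≤ n) (a : K) {b : K} (hb : b ≠ 0) :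
    homEval n p a b = b ^ n * aeval (a / b) p := by
  rw [← homEval_one_right hp, ← homEval_mul_mul, mul_div_cancel₀ _ hb, mul_one]

theorem natDegree_homEval_le (n N : ℕ) (p : k[X]) {a b : k[X]} (ha : a.natDegree ≤ N)
    (hb : b.natDegree ≤ N) : (homEval n p a b).natDegree ≤ n * N := by
  refine natDegree_sum_le_of_forall_le _ _ fun i hi ↦ ?_
  have h : n * N = 0 + i * N + (n - i) * N := by
    rw [zero_add, ← add_mul, Nat.add_sub_cancel' (by grind)]
  rw [h]
  exact natDegree_mul_le_of_le (natDegree_mul_le_of_le (natDegree_C _).le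
    (natDegree_pow_le_of_le _ ha)) (natDegree_pow_le_of_le _ hb)

theorem coeff_homEval (n N : ℕ) (p : k[X]) {a b : k[X]} (ha : a.natDegree ≤ N)
    (hb : b.natDegree ≤ N) :
    (homEval n p a b).coeff (n * N) = homEval n p (a.coeff N) (b.coeff N) := by
  rw [homEval, finsetSum_coeff, homEval]
  refine Finset.sum_congr rfl fun i hi ↦ ?_
  have h : n * N = i * N + (n - i) * N := by
    rw [← add_mul, Nat.add_sub_cancel' (by grind)]
  rw [algebraMap_eq, mul_assoc, coeff_C_mul, h, coeff_mul_add_eq_of_natDegree_le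
    (natDegree_pow_le_of_le _ ha) (natDegree_pow_le_of_le _ hb), coeff_pow_of_natDegree_le ha,
    coeff_pow_of_natDegree_le hb, Algebra.algebraMap_self_apply, mul_assoc]

theorem homEval_ne_zero_or {K : Type*} [Field K] [Algebra k K] {p q : k[X]} (hpq : IsCoprime p q)
    {a b : K} (hab : a ≠ 0 ∨ b ≠ 0) :
    homEval (max p.natDegree q.natDegree) p a b ≠ 0 ∨
      homEval (max p.natDegree q.natDegree) q a b ≠ 0 := by
  by_cases hb : b = 0
  · subst hb
    have ha : a ≠ 0 := by simpa using hab
    simp only [homEval_zero_right, ne_eq, mul_eq_zero, map_eq_zero, pow_eq_zero_iff', ha,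
      false_and, or_false]
    by_contra! h
    rcases le_total p.natDegree q.natDegree with hle | hle
    · rw [max_eq_right hle] at h
      have hq : q = 0 := leadingCoeff_eq_zero.1 h.2
      subst hq
      have h1 := h.1
      rw [natDegree_zero, ← Nat.le_zero.1 hle] at h1
      have hp : p = 0 := leadingCoeff_eq_zero.1 h1
      exact not_isCoprime_zero_zero (hp ▸ hpq)
    · rw [max_eq_left hle] at h
      have hp : p = 0 := leadingCoeff_eq_zero.1 h.1
      subst hp
      have h1 := h.2
      rw [natDegree_zero, ← Nat.le_zero.1 hle] at h1
      have hq : q = 0 := leadingCoeff_eq_zero.1 h1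
      exact not_isCoprime_zero_zero (hq ▸ hpq)
  · rw [homEval_eq_pow_mul_aeval_div (le_max_left _ _) _ hb,
      homEval_eq_pow_mul_aeval_div (le_max_right _ _) _ hb]
    simpa [hb] using aeval_ne_zero_of_isCoprime hpq (a / b)

theorem isCoprime_homEval {R : Type*} [CommRing R] [Algebra k R] {p q : k[X]}
    (hpq : IsCoprime p q) {a b : R} (hab : IsCoprime a b) :
    IsCoprime (homEval (max p.natDegree q.natDegree) p a b)
      (homEval (max p.natDegree q.natDegree) q a b) := by
  by_contra h
  rw [← Ideal.isCoprime_span_singleton_iff, Ideal.isCoprime_iff_sup_eq] at h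
  obtain ⟨M, hM, hle⟩ := Ideal.exists_le_maximal _ h
  let := Ideal.Quotient.field M
  have mem_left := hle (Ideal.mem_sup_left (Ideal.mem_span_singleton_self _))
  have mem_right := hle (Ideal.mem_sup_right (Ideal.mem_span_singleton_self _))
  rw [← Ideal.Quotient.eq_zero_iff_mem, ← Ideal.Quotient.mkₐ_eq_mk k, map_homEval]
    at mem_left mem_right
  refine (homEval_ne_zero_or (K := R ⧸ M) hpq ?_).elim (fun h ↦ h mem_left) fun h ↦ h mem_right
  by_contra! hab0
  obtain ⟨r, s, hrs⟩ := hab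
  have := congrArg (Ideal.Quotient.mkₐ k M) hrs
  rw [map_add, map_mul, map_mul, hab0.1, hab0.2, map_one] at this
  simp at this

/-- A binary form vanishing at `(a₀, b₀)` is divisible by the linear form vanishing there. -/
theorem dvd_homEval {n : ℕ} {p : k[X]} {a₀ b₀ : k} (h₀ : a₀ ≠ 0 ∨ b₀ ≠ 0)
    (hp : homEval n p a₀ b₀ = 0) (a b : k[X]) : C b₀ * a - C a₀ * b ∣ homEval n p a b := by
  set l := C b₀ * a - C a₀ * b with hl
  let φ := Ideal.Quotient.mkₐ k (Ideal.span {l})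
  have key : ∀ c, φ c = 0 ↔ l ∣ c := fun c ↦ by
    rw [← Ideal.mem_span_singleton, ← Ideal.Quotient.eq_zero_iff_mem]; rfl
  suffices ∃ c : k[X], φ a = φ (c * C a₀) ∧ φ b = φ (c * C b₀) by
    obtain ⟨c, ha, hb⟩ := this
    have h0 : homEval n p (C a₀) (C b₀) = 0 := by
      have := map_homEval (Algebra.ofId k k[X]) n p a₀ b₀
      rw [hp, map_zero] at this
      exact this.symm
    rw [← key, map_homEval, ha, hb, ← map_homEval, homEval_mul_mul, h0, mul_zero, map_zero]
  have hC : ∀ {x : k}, x ≠ 0 → (C x⁻¹ * C x : k[X]) = 1 := fun hx ↦ by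
    rw [← C_mul, inv_mul_cancel₀ hx, C_1]
  rcases h₀ with ha | hb
  · refine ⟨C a₀⁻¹ * a, ?_, ?_⟩ <;> rw [← sub_eq_zero, ← map_sub, key]
    · exact ⟨0, by linear_combination (-a) * hC ha⟩
    · exact ⟨-C a₀⁻¹, by rw [hl]; linear_combination (-b) * hC ha⟩
  · refine ⟨C b₀⁻¹ * b, ?_, ?_⟩ <;> rw [← sub_eq_zero, ← map_sub, key]
    · exact ⟨C b₀⁻¹, by rw [hl]; linear_combination (-a) * hC hb⟩
    · exact ⟨0, by linear_combination (-b) * hC hb⟩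

end HomogenizedEvaluation

section RatFunc

variable {K : Type*} [Field K]

theorem RatFunc.associated_num_denom_div {p q : K[X]} (hpq : IsCoprime p q) (hq : q ≠ 0) :
    Associated (algebraMap K[X] (RatFunc K) p / algebraMap K[X] (RatFunc K) q).num p ∧
      Associated (algebraMap K[X] (RatFunc K) p / algebraMap K[X] (RatFunc K) q).denom q := by
  set f := algebraMap K[X] (RatFunc K) p / algebraMap K[X] (RatFunc K) q with hf
  have h : f.num * q = p * f.denom := (num_mul_eq_mul_denom_iff hq).2 hf
  refine ⟨associated_of_dvd_dvd (num_div_dvd p hq) (hpq.dvd_of_dvd_mul_right ⟨f.denom, h⟩),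
    associated_of_dvd_dvd (denom_div_dvd p q) (hpq.symm.dvd_of_dvd_mul_left ⟨f.num, ?_⟩)⟩
  rw [← h, mul_comm]

theorem RatFunc.num_denom_div_of_monic {p q : K[X]} (hpq : IsCoprime p q) (hq : q.Monic) :
    (algebraMap K[X] (RatFunc K) p / algebraMap K[X] (RatFunc K) q).num = p ∧
      (algebraMap K[X] (RatFunc K) p / algebraMap K[X] (RatFunc K) q).denom = q := by
  have hd := eq_of_monic_of_associated (monic_denom _) hq
    (associated_num_denom_div hpq hq.ne_zero).2
  have h := (num_mul_eq_mul_denom_iff hq.ne_zero).2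
    (rfl : algebraMap K[X] (RatFunc K) p / algebraMap K[X] (RatFunc K) q = _)
  rw [hd] at h
  exact ⟨mul_right_cancel₀ hq.ne_zero h, hd⟩

theorem RatFunc.eval₂_C_mul_denom_pow {n : ℕ} {p : K[X]} (hp : p.natDegree ≤ n) (h : RatFunc K) :
    p.eval₂ RatFunc.C h * algebraMap K[X] (RatFunc K) h.denom ^ n =
      algebraMap K[X] (RatFunc K) (homEval n p h.num h.denom) := by
  have := map_homEval (IsScalarTower.toAlgHom K K[X] (RatFunc K)) n p h.num h.denom
  simp only [IsScalarTower.coe_toAlgHom'] at this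
  rw [this, homEval_eq_pow_mul_aeval_div hp _ (algebraMap_ne_zero h.denom_ne_zero),
    num_div_denom, mul_comm, aeval_def, algebraMap_eq_C]

theorem RatFunc.eval₂RingHom_C_injective {h : RatFunc K} (hh : ∀ c, h ≠ RatFunc.C c) :
    Function.Injective (eval₂RingHom RatFunc.C h) :=
  transcendental_iff_injective.1 (h.transcendental_of_ne_C fun ⟨c, hc⟩ ↦ hh c hc)

end RatFunc

theorem rcomp_eq_eval₂ (g h : RatFunc ℚ) :
    rcomp g h = g.num.eval₂ RatFunc.C h / g.denom.eval₂ RatFunc.C h := by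
  rw [rcomp, aeval_def, aeval_def, Subsingleton.elim (algebraMap ℚ (RatFunc ℚ)) RatFunc.C]

theorem nonconst_X : Nonconst RatFunc.X := by
  intro c hc
  have := congrArg RatFunc.num hc
  rw [RatFunc.num_X, RatFunc.num_C] at this
  exact X_ne_C c this

/-- Right composition with a nonconstant rational function, as a ring homomorphism. -/
noncomputable def rcompHom (h : RatFunc ℚ) (hh : Nonconst h) : RatFunc ℚ →+* RatFunc ℚ :=
  RatFunc.liftRingHom (eval₂RingHom RatFunc.C h)
    (nonZeroDivisors_le_comap_nonZeroDivisors_of_injective _ (RatFunc.eval₂RingHom_C_injective hh))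

theorem rcompHom_apply {h : RatFunc ℚ} (hh : Nonconst h) (g : RatFunc ℚ) :
    rcompHom h hh g = rcomp g h := by
  rw [rcomp_eq_eval₂]
  exact RatFunc.liftRingHom_apply _ _ _

theorem rcompHom_C {h : RatFunc ℚ} (hh : Nonconst h) (c : ℚ) :
    rcompHom h hh (RatFunc.C c) = RatFunc.C c := by
  simp

theorem rcomp_X_left (h : RatFunc ℚ) : rcomp RatFunc.X h = h := by
  simp [rcomp]

theorem rcomp_assoc (g u : RatFunc ℚ) {h : RatFunc ℚ} (hh : Nonconst h) :
    rcomp (rcomp g u) h = rcomp g (rcomp u h) := by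
  have hC : (rcompHom h hh).comp RatFunc.C = RatFunc.C := RingHom.ext (rcompHom_C hh)
  rw [← rcompHom_apply hh, ← rcompHom_apply hh, rcomp_eq_eval₂, rcomp_eq_eval₂, map_div₀,
    hom_eval₂, hom_eval₂, hC]

/-- The linear fractional expression `(a h + b) / (c h + d)`. -/
noncomputable def mobius (a b c d : ℚ) (h : RatFunc ℚ) : RatFunc ℚ :=
  (RatFunc.C a * h + RatFunc.C b) / (RatFunc.C c * h + RatFunc.C d)

theorem rcomp_mobius (a b c d : ℚ) (g : RatFunc ℚ) {h : RatFunc ℚ} (hh : Nonconst h) :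
    rcomp (mobius a b c d g) h = mobius a b c d (rcomp g h) := by
  simp only [← rcompHom_apply hh, mobius, map_div₀, map_add, map_mul, rcompHom_C]

theorem Nonconst.linear_ne_zero {h : RatFunc ℚ} (hh : Nonconst h) {c d : ℚ}
    (hcd : c ≠ 0 ∨ d ≠ 0) : RatFunc.C c * h + RatFunc.C d ≠ 0 := by
  intro h0
  by_cases hc : c = 0
  · simp_all
  · apply hh (-d / c)
    have hc' : RatFunc.C c ≠ 0 := by simpa using hc
    rw [map_div₀, map_neg, eq_div_iff hc']
    linear_combination h0

theorem mobius_mobius {a b c d : ℚ} (hdet : a * d - b * c ≠ 0) {h : RatFunc ℚ} (hh : Nonconst h) :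
    mobius d (-b) (-c) a (mobius a b c d h) = h := by
  have hne : RatFunc.C c * h + RatFunc.C d ≠ 0 := hh.linear_ne_zero (by
    by_contra! h0; simp [h0] at hdet)
  have hdet' : RatFunc.C a * RatFunc.C d - RatFunc.C b * RatFunc.C c ≠ 0 := by
    rw [← map_mul, ← map_mul, ← map_sub]
    exact (_root_.map_ne_zero RatFunc.C).2 hdet
  set w := mobius a b c d h with hw
  have hw' : w * (RatFunc.C c * h + RatFunc.C d) = RatFunc.C a * h + RatFunc.C b :=
    div_mul_cancel₀ _ hne
  have hden : RatFunc.C (-c) * w + RatFunc.C a ≠ 0 := by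
    intro h0
    rw [map_neg] at h0
    apply hdet'
    linear_combination (RatFunc.C c * h + RatFunc.C d) * h0 + RatFunc.C c * hw'
  rw [mobius, div_eq_iff hden]
  simp only [map_neg]
  linear_combination hw'

theorem Nonconst.mobius {a b c d : ℚ} (hdet : a * d - b * c ≠ 0) {h : RatFunc ℚ}
    (hh : Nonconst h) : Nonconst (mobius a b c d h) := by
  intro r hr
  have := mobius_mobius hdet hh
  rw [hr, _root_.mobius, ← map_mul, ← map_mul, ← map_add, ← map_add, ← map_div₀] at this
  exact hh _ this.symm

theorem isCompUnit_mobius {a b c d : ℚ} (hdet : a * d - b * c ≠ 0) :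
    IsCompUnit (mobius a b c d RatFunc.X) := by
  have hnc := nonconst_X.mobius hdet
  have heq : mobius a b c d RatFunc.X = algebraMap ℚ[X] (RatFunc ℚ) (C a * X + C b) /
      algebraMap ℚ[X] (RatFunc ℚ) (C c * X + C d) := by
    simp [mobius]
  have hp : C a * X + C b ≠ 0 := fun h0 ↦ hnc 0 (by rw [heq, h0]; simp)
  have hq : C c * X + C d ≠ 0 := fun h0 ↦ hnc 0 (by rw [heq, h0]; simp)
  set u := mobius a b c d RatFunc.X
  have h1 : u.num.natDegree ≤ 1 := by
    rw [heq]
    exact (natDegree_le_of_dvd (RatFunc.num_div_dvd _ hq) hp).trans natDegree_linear_le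
  have h2 : u.denom.natDegree ≤ 1 := by
    rw [heq]
    exact (natDegree_le_of_dvd (RatFunc.denom_div_dvd _ _) hq).trans natDegree_linear_le
  have h3 : ¬ (u.num.natDegree = 0 ∧ u.denom.natDegree = 0) := by
    rintro ⟨hn, hd⟩
    apply hnc (u.num.coeff 0 / u.denom.coeff 0)
    rw [map_div₀, ← RatFunc.algebraMap_C, ← RatFunc.algebraMap_C, ← eq_C_of_natDegree_eq_zero hn,
      ← eq_C_of_natDegree_eq_zero hd, RatFunc.num_div_denom]
  rw [IsCompUnit, rdeg]
  omega

theorem rcomp_eq_homEval_div (g h : RatFunc ℚ) :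
    rcomp g h = algebraMap ℚ[X] (RatFunc ℚ) (homEval (rdeg g) g.num h.num h.denom) /
      algebraMap ℚ[X] (RatFunc ℚ) (homEval (rdeg g) g.denom h.num h.denom) := by
  have hn : g.num.natDegree ≤ rdeg g := le_max_left _ _
  have hd : g.denom.natDegree ≤ rdeg g := le_max_right _ _
  rw [← RatFunc.eval₂_C_mul_denom_pow hn, ← RatFunc.eval₂_C_mul_denom_pow hd,
    mul_div_mul_right _ _ (pow_ne_zero _ (RatFunc.algebraMap_ne_zero h.denom_ne_zero)),
    rcomp_eq_eval₂]

/-- Let `f` be a nonconstant rational function in normal form, with coprime numerator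
`f.num` and denominator `f.denom`.  Every decomposition `f = g ∘ h` into nonconstant
rational functions is equivalent (via a unit `u` with compositional inverse `v`) to a
decomposition `f = (g ∘ u) ∘ (v ∘ h)` whose right component `h' = v ∘ h` is in normal
form with numerator a monic divisor of `f.num` and denominator a monic divisor of
`f.denom`. -/
theorem right_component_divides (f g h : RatFunc ℚ)
    (hf : Nonconst f) (hnf : NormalForm f)
    (hg : Nonconst g) (hh : Nonconst h) (hfe : f = rcomp g h) :
    ∃ u v : RatFunc ℚ, IsCompUnit u ∧
      rcomp u v = RatFunc.X ∧ rcomp v u = RatFunc.X ∧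
      f = rcomp (rcomp g u) (rcomp v h) ∧
      NormalForm (rcomp v h) ∧
      (rcomp v h).num.Monic ∧ (rcomp v h).num ∣ f.num ∧
      (rcomp v h).denom.Monic ∧ (rcomp v h).denom ∣ f.denom := by
  have hcop := h.isCoprime_num_denom
  set P := h.num
  set Q := h.denom
  set n := rdeg g
  set N := max P.natDegree Q.natDegree with hN
  have hPN : P.natDegree ≤ N := le_max_left _ _
  have hQN : Q.natDegree ≤ N := le_max_right _ _
  set F := homEval n g.num P Q
  set E := homEval n g.denom P Q
  have hfFE : f = algebraMap ℚ[X] (RatFunc ℚ) F / algebraMap ℚ[X] (RatFunc ℚ) E :=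
    hfe.trans (rcomp_eq_homEval_div g h)
  have hE0 : E ≠ 0 := fun h0 ↦ hf 0 (by rw [hfFE, h0]; simp)
  have hFE : IsCoprime F E := isCoprime_homEval g.isCoprime_num_denom hcop
  obtain ⟨hnum, hdenom⟩ := RatFunc.associated_num_denom_div hFE hE0
  rw [← hfFE] at hnum hdenom
  obtain ⟨p₀, hp₀⟩ : ∃ x, x = P.eval 0 := ⟨_, rfl⟩
  obtain ⟨q₀, hq₀⟩ : ∃ x, x = Q.eval 0 := ⟨_, rfl⟩
  obtain ⟨p₁, hp₁⟩ : ∃ x, x = P.coeff N := ⟨_, rfl⟩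
  obtain ⟨q₁, hq₁⟩ : ∃ x, x = Q.coeff N := ⟨_, rfl⟩
  have hpq₀ : p₀ ≠ 0 ∨ q₀ ≠ 0 := by
    rw [hp₀, hq₀]
    simpa using aeval_ne_zero_of_isCoprime hcop (0 : ℚ)
  have hpq₁ : p₁ ≠ 0 ∨ q₁ ≠ 0 := by
    rw [hp₁, hq₁]
    rcases le_total P.natDegree Q.natDegree with hle | hle
    · right
      rw [hN, max_eq_right hle]
      exact leadingCoeff_ne_zero.2 h.denom_ne_zero
    · left
      rw [hN, max_eq_left hle]
      exact leadingCoeff_ne_zero.2 fun h0 ↦ hh 0 (by rw [RatFunc.num_eq_zero_iff.1 h0, map_zero])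
  have hF₀ : homEval n g.num p₀ q₀ = 0 := by
    have h0 : F.eval 0 = 0 := by
      obtain ⟨r, hr⟩ := hnum.dvd
      rw [hr, eval_mul, hnf.2, zero_mul]
    have := map_homEval (aeval (0 : ℚ)) n g.num P Q
    simp only [coe_aeval_eq_eval] at this
    rw [hp₀, hq₀, ← this, h0]
  have hE₁ : homEval n g.denom p₁ q₁ = 0 := by
    rw [hp₁, hq₁, ← coeff_homEval n N _ hPN hQN]
    apply coeff_eq_zero_of_natDegree_lt
    have hdeg : ∀ {p q : ℚ[X]}, Associated p q → p.natDegree = q.natDegree :=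
      fun h ↦ natDegree_eq_of_degree_eq (degree_eq_degree_of_associated h)
    calc E.natDegree = f.denom.natDegree := hdeg hdenom.symm
      _ < f.num.natDegree := hnf.1
      _ = F.natDegree := hdeg hnum
      _ ≤ n * N := natDegree_homEval_le n N _ hPN hQN
  obtain ⟨Δ, hΔ⟩ : ∃ x, x = q₀ * p₁ - p₀ * q₁ := ⟨_, rfl⟩
  have hΔ0 : Δ ≠ 0 := by
    intro h0
    rw [hΔ] at h0
    obtain ⟨c, hcp, hcq⟩ : ∃ c, p₀ = c * p₁ ∧ q₀ = c * q₁ := by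
      rcases hpq₁ with h1 | h1
      · exact ⟨p₀ / p₁, by field_simp, by field_simp; linear_combination h0⟩
      · exact ⟨q₀ / q₁, by field_simp; linear_combination -h0, by field_simp⟩
    have hE₀ : homEval n g.denom p₀ q₀ = 0 := by
      rw [hcp, hcq, homEval_mul_mul, hE₁, mul_zero]
    exact (homEval_ne_zero_or g.isCoprime_num_denom hpq₀).elim (· hF₀) (· hE₀)
  have hN0 : 0 < N := by
    by_contra! h0
    apply hΔ0
    rw [hΔ, hp₀, hq₀, hp₁, hq₁, Nat.le_zero.1 h0, coeff_zero_eq_eval_zero, coeff_zero_eq_eval_zero]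
    ring
  set A := C q₀ * P - C p₀ * Q with hA
  set B := C q₁ * P - C p₁ * Q with hB
  have hAF : A ∣ F := dvd_homEval hpq₀ hF₀ P Q
  have hBE : B ∣ E := dvd_homEval hpq₁ hE₁ P Q
  have hlin : ∀ a b : ℚ, (C a * P - C b * Q).natDegree ≤ N := fun a b ↦
    (natDegree_sub_le _ _).trans <|
      max_le ((natDegree_C_mul_le a P).trans hPN) ((natDegree_C_mul_le b Q).trans hQN)
  have hAN : A.coeff N = Δ := by simp [hA, hΔ, hp₁, hq₁]
  have hBN : B.coeff N = 0 := by simp [hB, hp₁, hq₁, mul_comm]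
  have hAdeg : A.natDegree = N := natDegree_eq_of_le_of_coeff_ne_zero (hlin _ _) (hAN ▸ hΔ0)
  have hBdeg : B.natDegree < N := by
    refine lt_of_le_of_ne (hlin _ _) fun h0 ↦ ?_
    rw [← h0] at hBN
    have : B = 0 := leadingCoeff_eq_zero.1 hBN
    rw [this, natDegree_zero] at h0
    exact hN0.ne h0
  have hA0 : A.eval 0 = 0 := by simp [hA, ← hp₀, ← hq₀, mul_comm]
  have hBne : B ≠ 0 := by
    intro h0
    have : B.eval 0 = -Δ := by
      simp only [hB, eval_sub, eval_mul, eval_C, ← hp₀, ← hq₀, hΔ]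
      ring
    rw [h0, eval_zero] at this
    exact hΔ0 (by linarith)
  obtain ⟨β, hβ⟩ : ∃ x, x = B.leadingCoeff := ⟨_, rfl⟩
  have hβ0 : β ≠ 0 := hβ ▸ leadingCoeff_ne_zero.2 hBne
  have hC : ∀ {x : ℚ}, x ≠ 0 → (C x * C x⁻¹ : ℚ[X]) = 1 := fun hx ↦ by
    rw [← C_mul, mul_inv_cancel₀ hx, C_1]
  have hAA : C Δ⁻¹ * A ∣ A := ⟨C Δ, by linear_combination (-A) * hC hΔ0⟩
  have hBB : C β⁻¹ * B ∣ B := ⟨C β, by linear_combination (-B) * hC hβ0⟩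
  have hAmonic : (C Δ⁻¹ * A).Monic := by
    rw [Monic, leadingCoeff_mul, leadingCoeff_C, leadingCoeff, hAdeg, hAN, inv_mul_cancel₀ hΔ0]
  have hBmonic : (C β⁻¹ * B).Monic := by
    rw [Monic, leadingCoeff_mul, leadingCoeff_C, ← hβ, inv_mul_cancel₀ hβ0]
  have hAB : IsCoprime A B := by
    obtain ⟨r, s, hrs⟩ := hcop
    refine ⟨C Δ⁻¹ * (r * C p₁ + s * C q₁), -C Δ⁻¹ * (r * C p₀ + s * C q₀), ?_⟩
    have hCΔ : C Δ = C q₀ * C p₁ - C p₀ * C q₁ := by simp [hΔ]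
    rw [hA, hB]
    linear_combination C Δ * C Δ⁻¹ * hrs + hC hΔ0 - C Δ⁻¹ * (r * P + s * Q) * hCΔ
  obtain ⟨hvn, hvd⟩ := RatFunc.num_denom_div_of_monic
    ((hAB.of_isCoprime_of_dvd_left hAA).of_isCoprime_of_dvd_right hBB) hBmonic
  set a := Δ⁻¹ * q₀ with ha
  set b := -(Δ⁻¹ * p₀) with hb
  set c := β⁻¹ * q₁ with hc
  set d := -(β⁻¹ * p₁) with hd
  have hdet : a * d - b * c ≠ 0 := by
    have : a * d - b * c = -(Δ⁻¹ * β⁻¹ * Δ) := by rw [ha, hb, hc, hd, hΔ]; ring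
    rw [this]
    simp [hΔ0, hβ0]
  have hdet' : d * a - -b * -c ≠ 0 := by convert hdet using 1; ring
  have hvh : rcomp (mobius a b c d RatFunc.X) h = mobius a b c d h := by
    rw [rcomp_mobius _ _ _ _ _ hh, rcomp_X_left]
  have hv : rcomp (mobius a b c d RatFunc.X) h = algebraMap ℚ[X] (RatFunc ℚ) (C Δ⁻¹ * A) /
      algebraMap ℚ[X] (RatFunc ℚ) (C β⁻¹ * B) := by
    have hQ0 : algebraMap ℚ[X] (RatFunc ℚ) Q ≠ 0 := RatFunc.algebraMap_ne_zero h.denom_ne_zero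
    have hPQ : algebraMap ℚ[X] (RatFunc ℚ) P = h * algebraMap ℚ[X] (RatFunc ℚ) Q := by
      rw [← div_eq_iff hQ0]
      exact h.num_div_denom
    rw [hvh, mobius, ← mul_div_mul_right _ _ hQ0]
    congr 1
    · simp only [hA, ha, hb, map_mul, map_sub, map_neg, RatFunc.algebraMap_C, hPQ]
      ring
    · simp only [hB, hc, hd, map_mul, map_sub, map_neg, RatFunc.algebraMap_C, hPQ]
      ring
  refine ⟨mobius d (-b) (-c) a RatFunc.X, mobius a b c d RatFunc.X, isCompUnit_mobius hdet',
    ?_, ?_, ?_, ?_⟩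
  · rw [rcomp_mobius _ _ _ _ _ (nonconst_X.mobius hdet), rcomp_X_left,
      mobius_mobius hdet nonconst_X]
  · rw [rcomp_mobius _ _ _ _ _ (nonconst_X.mobius hdet'), rcomp_X_left]
    simpa only [neg_neg] using mobius_mobius hdet' nonconst_X
  · have hnc := hh.mobius hdet
    rw [hvh, rcomp_assoc _ _ hnc, rcomp_mobius _ _ _ _ _ hnc, rcomp_X_left, mobius_mobius hdet hh,
      hfe]
  · rw [NormalForm, hv, hvn, hvd]
    refine ⟨⟨?_, ?_⟩, hAmonic, hAA.trans (hAF.trans hnum.symm.dvd), hBmonic,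
      hBB.trans (hBE.trans hdenom.symm.dvd)⟩
    · rw [natDegree_C_mul (inv_ne_zero hΔ0), natDegree_C_mul (inv_ne_zero hβ0), hAdeg]
      exact hBdeg
    · rw [eval_mul, hA0, mul_zero]
end
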